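/- Let d ≥ 1, r > 0, and let P be a probability measure on ℝ^d with ∫|x|^r dP(x) < ∞. Let (a_n)_{n≥1} be an L^r-optimal greedy quantization sequence of P. Then for every probability measure ν on ℝ^d, every c ∈ (0,1/2) and every n ≥ 1, e_r(a^{(n)},P)^r − e_r(a^{(n+1)},P)^r ≥ ((1−c)^r − c^r)/(c+1)^r · ∫ ν(B(x, (c/(c+1))·d(x,a^{(n)}))) · d(x,a^{(n)})^r dP(x). -/

import Mathlib

open MeasureTheory Metric Set Real

/-- The `Lʳ`-quantization error `e_r(Γ, P) = (∫ d(x,Γ)^r dP(x))^(1/r)`. -/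
noncomputable def qerr {d : ℕ} (r : ℝ) (P : Measure (EuclideanSpace ℝ (Fin d)))
    (Γ : Set (EuclideanSpace ℝ (Fin d))) : ℝ :=
  (∫ x, infDist x Γ ^ r ∂P) ^ (1 / r)

/-- The first `n` points `a^{(n)} = {a_1, …, a_n}` of a sequence `(a_k)_{k ≥ 1}`. -/
def greedyGrid {d : ℕ} (a : ℕ → EuclideanSpace ℝ (Fin d)) (n : ℕ) :
    Set (EuclideanSpace ℝ (Fin d)) :=
  a '' Set.Icc 1 n

/-- `(a_n)_{n ≥ 1}` is an `Lʳ`-optimal greedy quantization sequence for `P`: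
`a_1` minimizes `ξ ↦ ∫ |x-ξ|^r dP(x)` and, given `a^{(n)}`, the point `a_{n+1}`
minimizes `ξ ↦ e_r(a^{(n)} ∪ {ξ}, P)`. -/
def IsGreedySeq {d : ℕ} (r : ℝ) (P : Measure (EuclideanSpace ℝ (Fin d)))
    (a : ℕ → EuclideanSpace ℝ (Fin d)) : Prop :=
  (∀ ξ, ∫ x, dist x (a 1) ^ r ∂P ≤ ∫ x, dist x ξ ^ r ∂P) ∧
    ∀ n, 1 ≤ n → ∀ ξ,
      qerr r P (greedyGrid a (n + 1)) ≤ qerr r P (insert ξ (greedyGrid a n))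

theorem qerr_rpow {d : ℕ} {r : ℝ} (hr : 0 < r) (P : Measure (EuclideanSpace ℝ (Fin d)))
    (Γ : Set (EuclideanSpace ℝ (Fin d))) :
    qerr r P Γ ^ r = ∫ x, infDist x Γ ^ r ∂P := by
  rw [qerr, one_div]
  exact Real.rpow_inv_rpow (integral_nonneg fun x => Real.rpow_nonneg infDist_nonneg r) hr.ne'

theorem greedyGrid_nonempty {d : ℕ} (a : ℕ → EuclideanSpace ℝ (Fin d)) {n : ℕ} (hn : 1 ≤ n) :
    (greedyGrid a n).Nonempty :=
  ⟨a 1, 1, ⟨le_rfl, hn⟩, rfl⟩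

theorem integrable_infDist_rpow {d : ℕ} {r : ℝ} (hr : 0 < r)
    (P : Measure (EuclideanSpace ℝ (Fin d))) [IsFiniteMeasure P]
    (hmom : Integrable (fun x => ‖x‖ ^ r) P) {Γ : Set (EuclideanSpace ℝ (Fin d))}
    (hΓ : Γ.Nonempty) : Integrable (fun x => infDist x Γ ^ r) P := by
  obtain ⟨y, hy⟩ := hΓ
  have hcont : Continuous fun x : EuclideanSpace ℝ (Fin d) => infDist x Γ ^ r :=
    (continuous_infDist_pt Γ).rpow_const fun _ => Or.inr hr.le
  refine ((hmom.add (integrable_const (‖y‖ ^ r))).const_mul (2 ^ r)).mono'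
    hcont.aestronglyMeasurable (Filter.Eventually.of_forall fun x => ?_)
  rw [Real.norm_of_nonneg (Real.rpow_nonneg infDist_nonneg r)]
  have hle : infDist x Γ ≤ 2 * max ‖x‖ ‖y‖ := by
    have h1 := infDist_le_dist_of_mem (x := x) hy
    have h2 := dist_le_norm_add_norm x y
    linarith [le_max_left ‖x‖ ‖y‖, le_max_right ‖x‖ ‖y‖]
  calc infDist x Γ ^ r ≤ (2 * max ‖x‖ ‖y‖) ^ r := Real.rpow_le_rpow infDist_nonneg hle hr.le
    _ = 2 ^ r * max ‖x‖ ‖y‖ ^ r := Real.mul_rpow two_pos.le (by positivity)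
    _ ≤ 2 ^ r * (‖x‖ ^ r + ‖y‖ ^ r) := by
      gcongr
      have hx : 0 ≤ ‖x‖ ^ r := by positivity
      have hy : 0 ≤ ‖y‖ ^ r := by positivity
      rcases max_choice ‖x‖ ‖y‖ with h | h <;> rw [h] <;> linarith

/-- If `ξ` lies within `c / (c + 1) * d(x, Γ)` of `x`, adding `ξ` to `Γ` decreases the local error
at `x` by a fixed fraction. -/
theorem mul_infDist_rpow_le_sub_insert {E : Type*} [PseudoMetricSpace E] {r c : ℝ} (hr : 0 < r)
    (hc : c ∈ Set.Ioo (0 : ℝ) (1 / 2)) {Γ : Set E} {x ξ : E}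
    (h : dist x ξ ≤ c / (c + 1) * infDist x Γ) :
    ((1 - c) ^ r - c ^ r) / (c + 1) ^ r * infDist x Γ ^ r ≤
      infDist x Γ ^ r - infDist x (insert ξ Γ) ^ r := by
  obtain ⟨hc0, hc1⟩ := hc
  have hpos : 0 < (c + 1) ^ r := by positivity
  have hD : 0 ≤ infDist x Γ ^ r := Real.rpow_nonneg infDist_nonneg r
  have hins : infDist x (insert ξ Γ) ^ r ≤ c ^ r / (c + 1) ^ r * infDist x Γ ^ r := by
    rw [← Real.div_rpow hc0.le (by positivity), ← Real.mul_rpow (by positivity) infDist_nonneg]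
    exact Real.rpow_le_rpow infDist_nonneg
      ((infDist_le_dist_of_mem (mem_insert ξ Γ)).trans h) hr.le
  have hone : (1 - c) ^ r / (c + 1) ^ r ≤ 1 :=
    (div_le_one hpos).2 (Real.rpow_le_rpow (by linarith) (by linarith) hr.le)
  have := mul_le_mul_of_nonneg_right hone hD
  rw [sub_div, sub_mul]
  linarith

/-- micro-macro inequality for greedy quantization sequences. -/
theorem stmt1 (d : ℕ) (hd : 1 ≤ d) (r : ℝ) (hr : 0 < r)
    (P : Measure (EuclideanSpace ℝ (Fin d))) [IsProbabilityMeasure P]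
    (hmom : Integrable (fun x => ‖x‖ ^ r) P)
    (a : ℕ → EuclideanSpace ℝ (Fin d)) (ha : IsGreedySeq r P a)
    (ν : Measure (EuclideanSpace ℝ (Fin d))) [IsProbabilityMeasure ν]
    (c : ℝ) (hc : c ∈ Set.Ioo (0 : ℝ) (1 / 2)) (n : ℕ) (hn : 1 ≤ n) :
    ((1 - c) ^ r - c ^ r) / (c + 1) ^ r *
        ∫ x, (ν (closedBall x (c / (c + 1) * infDist x (greedyGrid a n)))).toReal *
          infDist x (greedyGrid a n) ^ r ∂P ≤
      qerr r P (greedyGrid a n) ^ r - qerr r P (greedyGrid a (n + 1)) ^ r := by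
  set Γ := greedyGrid a n
  set K : ℝ := ((1 - c) ^ r - c ^ r) / (c + 1) ^ r
  have hne : Γ.Nonempty := greedyGrid_nonempty a hn
  have hD := integrable_infDist_rpow hr P hmom hne
  let S : Set (EuclideanSpace ℝ (Fin d) × EuclideanSpace ℝ (Fin d)) :=
    {p | dist p.1 p.2 ≤ c / (c + 1) * infDist p.1 Γ}
  have hS : MeasurableSet S :=
    (isClosed_le continuous_dist
      (((continuous_infDist_pt Γ).comp continuous_fst).const_mul _)).measurableSet
  let f : EuclideanSpace ℝ (Fin d) → EuclideanSpace ℝ (Fin d) → ℝ :=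
    fun x ξ => S.indicator (fun p => infDist p.1 Γ ^ r) (x, ξ)
  have hf : Integrable (Function.uncurry f) (P.prod ν) := (hD.comp_fst ν).indicator hS
  have hinner (x : EuclideanSpace ℝ (Fin d)) :
      ∫ ξ, f x ξ ∂ν =
        (ν (closedBall x (c / (c + 1) * infDist x Γ))).toReal * infDist x Γ ^ r := by
    have : f x = (closedBall x (c / (c + 1) * infDist x Γ)).indicator
        fun _ => infDist x Γ ^ r := by
      ext ξ
      simp [f, S, Set.indicator, dist_comm x ξ]
    rw [this, integral_indicator_const _ isClosed_closedBall.measurableSet, smul_eq_mul]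
    rfl
  have hlocal : ∀ᵐ ξ ∂ν, K * ∫ x, f x ξ ∂P ≤
      qerr r P Γ ^ r - qerr r P (greedyGrid a (n + 1)) ^ r := by
    filter_upwards [hf.prod_left_ae] with ξ hξ
    have hI := integrable_infDist_rpow hr P hmom (insert_nonempty ξ Γ)
    have hgreedy : qerr r P (greedyGrid a (n + 1)) ^ r ≤ qerr r P (insert ξ Γ) ^ r :=
      Real.rpow_le_rpow
        (Real.rpow_nonneg (integral_nonneg fun x => Real.rpow_nonneg infDist_nonneg r) _)
        (ha.2 n hn ξ) hr.le
    refine le_trans ?_ (sub_le_sub_left hgreedy _)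
    rw [qerr_rpow hr, qerr_rpow hr, ← integral_sub hD hI, ← integral_const_mul]
    refine integral_mono (hξ.const_mul K) (hD.sub hI) fun x => ?_
    by_cases hx : (x, ξ) ∈ S
    · simpa only [f, Set.indicator_of_mem hx] using mul_infDist_rpow_le_sub_insert hr hc hx
    · simp only [f, Set.indicator_of_notMem hx, mul_zero, sub_nonneg]
      exact Real.rpow_le_rpow infDist_nonneg
        (infDist_le_infDist_of_subset (subset_insert ξ Γ) hne) hr.le
  simp_rw [← hinner]
  rw [integral_integral_swap hf, ← integral_const_mul]
  simpa using integral_mono_ae (hf.integral_prod_right.const_mul K) (integrable_const _) hlocal
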